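/- Let d ≥ 1 be an integer and let μ be the Gauss measure on [0,1]. For each k ≥ 1, let C_k ⊆ (ℕ_{>0})^d and set P_k = ⋃_{(a_1,…,a_d) ∈ C_k} I_d(a_1,…,a_d). Then μ({ x ∈ [0,1) : T^k(x) ∈ P_k for infinitely many k ∈ ℕ }) equals 0 if the series ∑_{k=1}^∞ μ(P_k) converges, and equals 1 if the series ∑_{k=1}^∞ μ(P_k) diverges. -/

import Mathlib

open MeasureTheory Filter Set

/-- The Gauss map `T(x) = 1/x - ⌊1/x⌋` (with `T(0) = 0`). -/
noncomputable def gaussMap (x : ℝ) : ℝ := if x = 0 then 0 else 1 / x - (⌊1 / x⌋ : ℝ)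

/-- The `n`-th partial quotient `a_n(x) = ⌊1 / T^{n-1}(x)⌋` (for `n ≥ 1`). -/
noncomputable def pq (n : ℕ) (x : ℝ) : ℕ := ⌊1 / (gaussMap^[n - 1] x)⌋₊

/-- `Λ_d(Φ)`: irrational `x ∈ [0,1)` with `a_n(x) a_{2n}(x) ⋯ a_{dn}(x) ≥ Φ(n)`
for infinitely many `n`. -/
def Lambda (d : ℕ) (Φ : ℕ → ℝ) : Set ℝ :=
  {x | x ∈ Set.Ico (0 : ℝ) 1 ∧ Irrational x ∧
    ∃ᶠ n in Filter.atTop, Φ n ≤ ∏ i ∈ Finset.Icc 1 d, (pq (i * n) x : ℝ)}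

/-- The Gauss measure `μ(A) = (1/log 2) ∫_A 1/(1+x) dx` on `[0,1]`. -/
noncomputable def gaussMeasure : Measure ℝ :=
  (volume.restrict (Set.Icc (0 : ℝ) 1)).withDensity fun x =>
    ENNReal.ofReal ((Real.log 2)⁻¹ * (1 + x)⁻¹)

/-- The cylinder `I_d(a_1,…,a_d)` of order `d`. -/
def cylinder (d : ℕ) (a : Fin d → ℕ+) : Set ℝ :=
  {x | x ∈ Set.Ico (0 : ℝ) 1 ∧ Irrational x ∧ ∀ i : Fin d, pq ((i : ℕ) + 1) x = (a i : ℕ)}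


namespace GBC

def X : Set ℝ := {x | x ∈ Set.Ioo (0 : ℝ) 1 ∧ Irrational x}

lemma X_meas : MeasurableSet X := by
  have h : X = Set.Ioo (0:ℝ) 1 \ Set.range ((↑) : ℚ → ℝ) := rfl
  rw [h]
  exact measurableSet_Ioo.diff (Set.countable_range _).measurableSet

lemma X_ae (A : Set ℝ) (hA : A ⊆ Set.Icc 0 1) : volume (A \ X) = 0 := by
  have hc : (Set.range ((↑) : ℚ → ℝ)).Countable := Set.countable_range _
  refine measure_mono_null ?_ (hc.measure_zero volume)
  rintro x ⟨hx, hxX⟩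
  by_contra hirr
  apply hxX
  have hx1 := hA hx
  refine ⟨⟨lt_of_le_of_ne hx1.1 ?_, lt_of_le_of_ne hx1.2 ?_⟩, hirr⟩
  · rintro rfl; exact hirr ⟨0, by simp⟩
  · rintro rfl; exact hirr ⟨1, by simp⟩

lemma X_vol : volume X = 1 := by
  have h1 : volume X ≤ volume (Set.Icc (0:ℝ) 1) :=
    measure_mono (fun x hx => ⟨hx.1.1.le, hx.1.2.le⟩)
  have h2 : volume (Set.Icc (0:ℝ) 1) ≤ volume X + volume (Set.Icc (0:ℝ) 1 \ X) := by
    refine le_trans (measure_mono ?_) (measure_union_le _ _)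
    intro x hx
    by_cases h : x ∈ X
    · exact Or.inl h
    · exact Or.inr ⟨hx, h⟩
  rw [X_ae _ subset_rfl, add_zero] at h2
  have := le_antisymm h1 h2
  simpa using this

lemma T_meas : Measurable gaussMap := by
  unfold gaussMap
  refine Measurable.ite (measurableSet_singleton 0) measurable_const ?_
  have : Measurable fun x : ℝ => 1 / x := by fun_prop
  exact this.sub ((Measurable.of_discrete (f := fun z : ℤ => (z:ℝ))).comp (Int.measurable_floor.comp this))

lemma T_X {x : ℝ} (hx : x ∈ X) : gaussMap x ∈ X := by
  have h0 : x ≠ 0 := hx.1.1.ne'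
  have hirr : Irrational (1 / x - (⌊1 / x⌋ : ℝ)) := by
    have : Irrational (1/x) := by simpa using hx.2.inv
    exact this.sub_intCast _
  rw [gaussMap, if_neg h0]
  refine ⟨⟨lt_of_le_of_ne ?_ ?_, ?_⟩, hirr⟩
  · exact sub_nonneg.2 (Int.floor_le _)
  · intro h; exact hirr ⟨0, by simpa using h⟩
  · linarith [Int.lt_floor_add_one (1/x)]

lemma Tn_X (n : ℕ) {x : ℝ} (hx : x ∈ X) : gaussMap^[n] x ∈ X := by
  induction n with
  | zero => exact hx
  | succ n ih => rw [Function.iterate_succ_apply']; exact T_X ih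

lemma pq_meas (n : ℕ) : Measurable (pq n) := by
  unfold pq
  have h1 := T_meas.iterate (n-1)
  have : Measurable fun x : ℝ => 1 / (gaussMap^[n-1] x) := by fun_prop
  exact Nat.measurable_floor.comp this

lemma pq_iter (i k : ℕ) (x : ℝ) : pq (i+1) (gaussMap^[k] x) = pq (k + i + 1) x := by
  simp only [pq, Nat.add_sub_cancel]
  rw [← Function.iterate_add_apply, add_comm]

def Z (n : ℕ) (w : Fin n → ℕ) : Set ℝ := {x | x ∈ X ∧ ∀ i : Fin n, pq ((i:ℕ)+1) x = w i}

lemma Z_meas (n : ℕ) (w : Fin n → ℕ) : MeasurableSet (Z n w) := by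
  have : Z n w = X ∩ ⋂ i : Fin n, (pq ((i:ℕ)+1)) ⁻¹' {w i} := by
    ext x; simp [Z]
  rw [this]
  exact X_meas.inter (MeasurableSet.iInter fun i => pq_meas _ (measurableSet_singleton _))

lemma branch (b : ℕ) (hb : 1 ≤ b) (S : Set ℝ) (hS : S ⊆ X) :
    {t | t ∈ X ∧ pq 1 t = b ∧ gaussMap t ∈ S} = (fun s : ℝ => 1 / (b + s)) '' S := by
  have hb' : (1:ℝ) ≤ b := by exact_mod_cast hb
  ext t
  simp only [Set.mem_ofPred_eq, Set.mem_image]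
  constructor
  · rintro ⟨hX, hp, hT⟩
    refine ⟨_, hT, ?_⟩
    have h0 : t ≠ 0 := hX.1.1.ne'
    have hpos : 0 ≤ 1 / t := (one_div_pos.2 hX.1.1).le
    have hp' : ⌊1/t⌋₊ = b := hp
    have hf : (⌊1/t⌋ : ℝ) = b := by
      rw [← hp', natCast_floor_eq_intCast_floor hpos]
    rw [gaussMap, if_neg h0, hf]
    simp
  · rintro ⟨s, hs, rfl⟩
    have hsX := hS hs
    have hs0 := hsX.1.1
    have hs1 := hsX.1.2
    have hpos : (0:ℝ) < b + s := by linarith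
    have hfl : ⌊(b:ℝ) + s⌋ = b := by
      rw [Int.floor_eq_iff]; push_cast; constructor <;> linarith
    refine ⟨⟨⟨one_div_pos.2 hpos, ?_⟩, ?_⟩, ?_, ?_⟩
    · rw [div_lt_one hpos]; linarith
    · have : Irrational ((b:ℝ) + s) := hsX.2.natCast_add b
      simpa using this.inv
    · show ⌊1 / (1 / ((b:ℝ) + s))⌋₊ = b
      rw [one_div_one_div, Nat.floor_eq_iff hpos.le]
      constructor <;> linarith
    · rw [gaussMap, if_neg (one_div_pos.2 hpos).ne', one_div_one_div, hfl]
      simpa using hs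

lemma branch_int (b : ℕ) (hb : 1 ≤ b) (S : Set ℝ) (hS : S ⊆ X) (hm : MeasurableSet S)
    (K q q' : ℝ) (hq : 0 < q) (hq' : 0 ≤ q') :
    ∫⁻ t in {t | t ∈ X ∧ pq 1 t = b ∧ gaussMap t ∈ S}, ENNReal.ofReal (K / (q + q' * t)^2)
      = ∫⁻ s in S, ENNReal.ofReal (K / ((q * b + q') + q * s)^2) := by
  have hb' : (1:ℝ) ≤ b := by exact_mod_cast hb
  rw [branch b hb S hS]
  rw [lintegral_image_eq_lintegral_abs_deriv_mul hm (f' := fun s => -1 / ((b:ℝ)+s)^2)]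
  · refine setLIntegral_congr_fun hm ?_
    intro s hs
    have hs0 := (hS hs).1.1
    have hpos : (0:ℝ) < b + s := by linarith
    simp only
    rw [← ENNReal.ofReal_mul (abs_nonneg _)]
    congr 1
    rw [neg_div, abs_neg, abs_of_pos (by positivity)]
    have h1 : 0 < q * b + q' + q * s := by nlinarith
    have h2 : q + q' * (1 / (b + s)) = (q * b + q' + q * s) / (b + s) := by
      field_simp; ring
    rw [h2]
    field_simp
  · intro s hs
    have hs0 := (hS hs).1.1
    have hpos : (0:ℝ) < b + s := by linarith
    have h := ((hasDerivAt_id s).const_add (b:ℝ)).inv hpos.ne'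
    have h2 := h.hasDerivWithinAt (s := S)
    simp only [one_div]
    exact h2
  · intro s hs t ht hst
    have hs0 := (hS hs).1.1
    have ht0 := (hS ht).1.1
    have h1 : (b:ℝ) + s = b + t := by
      have : 1 / ((b:ℝ) + s) = 1 / (b + t) := hst
      simpa using this
    linarith

lemma dens (n : ℕ) (w : Fin n → ℕ) : ∃ K q q' : ℝ, 0 ≤ K ∧ 0 < q ∧ 0 ≤ q' ∧ q' ≤ q ∧
    ∀ S ⊆ X, MeasurableSet S → volume (Z n w ∩ gaussMap^[n] ⁻¹' S)
      = ∫⁻ t in S, ENNReal.ofReal (K / (q + q' * t)^2) := by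
  induction n with
  | zero =>
    refine ⟨1, 1, 0, by norm_num, by norm_num, le_rfl, by norm_num, ?_⟩
    intro S hS hm
    have : Z 0 w ∩ gaussMap^[0] ⁻¹' S = S := by
      ext x; simp only [Z, Set.mem_inter_iff, Set.mem_ofPred_eq, Set.mem_preimage, Function.iterate_zero, id]
      exact ⟨fun h => h.2, fun h => ⟨⟨hS h, fun i => i.elim0⟩, h⟩⟩
    rw [this]; simp
  | succ n ih =>
    obtain ⟨K, q, q', hK, hq, hq', hqq, H⟩ := ih (fun i => w i.castSucc)
    have key : ∀ S : Set ℝ, Z (n+1) w ∩ gaussMap^[n+1] ⁻¹' S =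
        Z n (fun i => w i.castSucc) ∩ gaussMap^[n] ⁻¹'
          {t | t ∈ X ∧ pq 1 t = w (Fin.last n) ∧ gaussMap t ∈ S} := by
      intro S
      ext x
      have h1 : pq 1 (gaussMap^[n] x) = pq (n+1) x := pq_iter 0 n x
      simp only [Z, Set.mem_inter_iff, Set.mem_ofPred_eq, Set.mem_preimage,
        Fin.forall_fin_succ', Function.iterate_succ_apply', h1, Fin.val_castSucc, Fin.val_last]
      constructor
      · rintro ⟨⟨a, b, c⟩, e⟩; exact ⟨⟨a, b⟩, Tn_X n a, c, e⟩
      · rintro ⟨⟨a, b⟩, _, c, e⟩; exact ⟨⟨a, b, c⟩, e⟩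
    rcases Nat.eq_zero_or_pos (w (Fin.last n)) with h0 | hpos
    · refine ⟨0, 1, 0, le_rfl, by norm_num, le_rfl, by norm_num, ?_⟩
      intro S hS hm
      rw [key, h0]
      have : {t | t ∈ X ∧ pq 1 t = 0 ∧ gaussMap t ∈ S} = ∅ := by
        ext t
        simp only [Set.mem_ofPred_eq, Set.mem_empty_iff_false, iff_false]
        rintro ⟨hX, hp, _⟩
        have hp' : ⌊1/t⌋₊ = 0 := hp
        rw [Nat.floor_eq_zero, div_lt_one hX.1.1] at hp'
        linarith [hX.1.2]
      rw [this]; simp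
    · have hb' : (1:ℝ) ≤ w (Fin.last n) := by exact_mod_cast hpos
      refine ⟨K, q * w (Fin.last n) + q', q, hK, by nlinarith, hq.le, by nlinarith, ?_⟩
      intro S hS hm
      rw [key, H _ (fun t ht => ht.1), branch_int _ hpos S hS hm K q q' hq hq']
      exact (X_meas.inter ((pq_meas 1 (measurableSet_singleton _)).inter (T_meas hm)))

lemma Z_good (n : ℕ) (w : Fin n → ℕ) (S : Set ℝ) (hS : S ⊆ X) (hm : MeasurableSet S) :
    volume (Z n w) * volume S ≤ 4 * volume (Z n w ∩ gaussMap^[n] ⁻¹' S) ∧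
    volume (Z n w ∩ gaussMap^[n] ⁻¹' S) ≤ 4 * (volume (Z n w) * volume S) := by
  obtain ⟨K, q, q', hK, hq, hq', hqq, H⟩ := dens n w
  set A := ENNReal.ofReal (K / q^2) with hA
  have up : ∀ S ⊆ X, MeasurableSet S →
      volume (Z n w ∩ gaussMap^[n] ⁻¹' S) ≤ A * volume S := by
    intro S hS hm
    rw [H S hS hm, ← setLIntegral_const]
    refine setLIntegral_mono' hm ?_
    intro t ht
    have := (hS ht).1.1
    apply ENNReal.ofReal_le_ofReal
    apply div_le_div_of_nonneg_left hK (by positivity)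
    apply pow_le_pow_left₀ hq.le
    nlinarith
  have lo : ∀ S ⊆ X, MeasurableSet S →
      A * volume S ≤ 4 * volume (Z n w ∩ gaussMap^[n] ⁻¹' S) := by
    intro S hS hm
    rw [H S hS hm, ← setLIntegral_const, ← lintegral_const_mul' _ _ (by norm_num)]
    refine setLIntegral_mono' hm ?_
    intro t ht
    have h0 := (hS ht).1.1
    have h1 := (hS ht).1.2
    have : (4:ENNReal) = ENNReal.ofReal 4 := by norm_num
    rw [this, ← ENNReal.ofReal_mul (by norm_num)]
    apply ENNReal.ofReal_le_ofReal
    have hle : q + q' * t ≤ 2 * q := by nlinarith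
    have hp : 0 < q + q' * t := by positivity
    have : (q + q' * t)^2 ≤ (2*q)^2 := pow_le_pow_left₀ hp.le hle 2
    rw [← mul_div_assoc, div_le_div_iff₀ (by positivity) (by positivity)]
    nlinarith
  have hX : Z n w ∩ gaussMap^[n] ⁻¹' X = Z n w := by
    ext x; exact ⟨fun h => h.1, fun h => ⟨h, Tn_X n h.1⟩⟩
  have uX := up X subset_rfl X_meas
  have lX := lo X subset_rfl X_meas
  rw [hX, X_vol, mul_one] at uX lX
  constructor
  · exact (mul_le_mul_left uX _).trans (lo S hS hm)
  · refine (up S hS hm).trans ?_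
    rw [← mul_assoc]
    exact mul_le_mul_left lX _

def IsF (n : ℕ) (E : Set ℝ) : Prop := E ⊆ X ∧ ∀ x ∈ X, ∀ y ∈ X,
  (∀ i < n, pq (i+1) x = pq (i+1) y) → x ∈ E → y ∈ E

lemma F_union {n : ℕ} {E : Set ℝ} (hE : IsF n E) (Y : Set ℝ) :
    E ∩ Y = ⋃ w : {w : Fin n → ℕ // ∃ x ∈ E, ∀ i : Fin n, pq ((i:ℕ)+1) x = w i}, Z n w.1 ∩ Y := by
  ext x
  simp only [Set.mem_iUnion, Set.mem_inter_iff, exists_and_right]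
  refine and_congr_left fun _ => ?_
  constructor
  · intro hx
    exact ⟨⟨fun i => pq ((i:ℕ)+1) x, x, hx, fun i => rfl⟩, hE.1 hx, fun i => rfl⟩
  · rintro ⟨⟨w, y, hy, hyw⟩, hx, hxw⟩
    refine hE.2 y (hE.1 hy) x hx (fun i hi => ?_) hy
    rw [hyw ⟨i, hi⟩, hxw ⟨i, hi⟩]

lemma F_meas {n : ℕ} {E : Set ℝ} (hE : IsF n E) : MeasurableSet E := by
  have := F_union hE Set.univ
  simp only [Set.inter_univ] at this
  rw [this]
  exact MeasurableSet.iUnion fun w => Z_meas _ _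

lemma F_vol {n : ℕ} {E : Set ℝ} (hE : IsF n E) (Y : Set ℝ) (hY : MeasurableSet Y) :
    volume (E ∩ Y) = ∑' w : {w : Fin n → ℕ // ∃ x ∈ E, ∀ i : Fin n, pq ((i:ℕ)+1) x = w i},
      volume (Z n w.1 ∩ Y) := by
  rw [F_union hE, measure_iUnion]
  · intro w w' hne
    refine Set.disjoint_left.2 fun x hx hx' => hne (Subtype.ext (funext fun i => ?_))
    rw [← hx.1.2 i, hx'.1.2 i]
  · exact fun w => (Z_meas _ _).inter hY

lemma F_good {n : ℕ} {E : Set ℝ} (hE : IsF n E) (S : Set ℝ) (hS : S ⊆ X) (hm : MeasurableSet S) :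
    volume E * volume S ≤ 4 * volume (E ∩ gaussMap^[n] ⁻¹' S) ∧
    volume (E ∩ gaussMap^[n] ⁻¹' S) ≤ 4 * (volume E * volume S) := by
  have h1 := F_vol hE Set.univ MeasurableSet.univ
  simp only [Set.inter_univ] at h1
  rw [F_vol hE _ (T_meas.iterate n hm), h1, ← ENNReal.tsum_mul_right, ← ENNReal.tsum_mul_left,
    ← ENNReal.tsum_mul_left]
  exact ⟨ENNReal.tsum_le_tsum fun w => (Z_good n w.1 S hS hm).1,
    ENNReal.tsum_le_tsum fun w => (Z_good n w.1 S hS hm).2⟩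

lemma P_F (d : ℕ) (C : Set (Fin d → ℕ+)) : IsF d (⋃ a ∈ C, cylinder d a) := by
  refine ⟨?_, ?_⟩
  · intro x hx
    simp only [Set.mem_iUnion] at hx
    obtain ⟨a, _, h1, h2, _⟩ := hx
    refine ⟨⟨lt_of_le_of_ne h1.1 ?_, h1.2⟩, h2⟩
    rintro rfl
    exact h2 ⟨0, by simp⟩
  · intro x hx y hy h hxE
    simp only [Set.mem_iUnion] at hxE ⊢
    obtain ⟨a, ha, _, _, h3⟩ := hxE
    exact ⟨a, ha, ⟨hy.1.1.le, hy.1.2⟩, hy.2, fun i => by rw [← h i i.2, h3]⟩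

lemma X_F (n : ℕ) : IsF n X := ⟨subset_rfl, fun _ _ _ hy _ _ => hy⟩

def B (P : ℕ → Set ℝ) (m n : ℕ) : Set ℝ :=
  {x | x ∈ X ∧ ∀ k, m ≤ k → k < m + n → gaussMap^[k] x ∉ P k}

lemma B_F (d : ℕ) (P : ℕ → Set ℝ) (hP : ∀ k, IsF d (P k)) (m n : ℕ) :
    IsF (m + n + d) (B P m n) := by
  refine ⟨fun x hx => hx.1, ?_⟩
  intro x hx y hy h hxB
  refine ⟨hy, fun k hk hk' hyP => hxB.2 k hk hk' ?_⟩
  refine (hP k).2 _ (Tn_X k hy) _ (Tn_X k hx) (fun i hi => ?_) hyP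
  rw [pq_iter, pq_iter, h _ (by omega)]

lemma B_step (d : ℕ) (P : ℕ → Set ℝ) (hP : ∀ k, IsF d (P k)) (m n : ℕ) :
    volume (⋂ j, B P m j) * volume (P (m + n + d)) + 4 * volume (B P m (n + (d+1)))
      ≤ 4 * volume (B P m n) := by
  have h := (F_good (B_F d P hP m n) (P (m+n+d)) (hP _).1 (F_meas (hP _))).1
  have h1 : volume (⋂ j, B P m j) ≤ volume (B P m n) := measure_mono (Set.iInter_subset _ _)
  have hm := T_meas.iterate (m+n+d) (F_meas (hP (m+n+d)))
  calc _ ≤ 4 * volume (B P m n ∩ gaussMap^[m+n+d] ⁻¹' P (m+n+d))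
        + 4 * volume (B P m n \ gaussMap^[m+n+d] ⁻¹' P (m+n+d)) := by
        refine add_le_add ((mul_le_mul_left h1 _).trans h) (mul_le_mul_right (measure_mono ?_) _)
        intro x hx
        refine ⟨⟨hx.1, fun k h1 h2 => hx.2 k h1 (by omega)⟩, hx.2 _ (by omega) (by omega)⟩
    _ = _ := by rw [← mul_add, measure_inter_add_sdiff _ hm]

lemma tele (d : ℕ) (b c : ℕ → ENNReal) (h : ∀ n, c n + b (n + (d+1)) ≤ b n) (N : ℕ) :
    ∑ n ∈ Finset.range N, c n + ∑ n ∈ Finset.range (d+1), b (N + n)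
      ≤ ∑ n ∈ Finset.range (d+1), b n := by
  induction N with
  | zero => simp
  | succ N ih =>
    refine le_trans ?_ ih
    rw [Finset.sum_range_succ, Finset.sum_range_succ, add_assoc]
    rw [Finset.sum_range_succ' (fun n => b (N + n))]
    refine add_le_add_right ?_ _
    have e : ∀ n, b (N + 1 + n) = b (N + (n+1)) := fun n => by congr 1; omega
    simp only [e]
    rw [add_left_comm]
    refine add_le_add_right (h N) _

lemma B_null (d : ℕ) (P : ℕ → Set ℝ) (hP : ∀ k, IsF d (P k))
    (hdiv : ∑' k, volume (P k) = ⊤) (m : ℕ) : volume (⋂ j, B P m j) = 0 := by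
  by_contra hL
  have htop : ∑' n, volume (P (m + n + d)) = ⊤ := by
    have h := ENNReal.summable.sum_add_tsum_nat_add' (f := fun k => volume (P k)) (k := m + d)
    rw [hdiv] at h
    have hfin : ∑ i ∈ Finset.range (m+d), volume (P i) ≠ ⊤ := by
      refine (ENNReal.sum_lt_top.2 fun i _ => ?_).ne
      refine lt_of_le_of_lt (measure_mono (hP i).1) ?_
      rw [X_vol]; exact ENNReal.one_lt_top
    rcases ENNReal.add_eq_top.1 h with h | h
    · exact absurd h hfin
    · rw [← h]; congr 1; ext n; congr 2; omega
  have hb : ∀ n, volume (B P m n) ≤ 1 := fun n => by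
    rw [← X_vol]; exact measure_mono fun x hx => hx.1
  have h1 : ∑' n, volume (⋂ j, B P m j) * volume (P (m + n + d)) ≤
      ∑ n ∈ Finset.range (d+1), 4 * volume (B P m n) := by
    rw [ENNReal.tsum_eq_iSup_nat]
    refine iSup_le fun N => ?_
    exact le_trans le_self_add (tele d (fun n => 4 * volume (B P m n)) _ (B_step d P hP m) N)
  rw [ENNReal.tsum_mul_left, htop, ENNReal.mul_top hL, top_le_iff] at h1
  refine absurd h1 (ENNReal.sum_lt_top.2 fun i _ => ?_).ne
  exact ENNReal.mul_lt_top (by norm_num) (lt_of_le_of_lt (hb i) ENNReal.one_lt_top)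

lemma gm_le (A : Set ℝ) (hA : MeasurableSet A) : gaussMeasure A ≤ 2 * volume A := by
  rw [gaussMeasure, withDensity_apply _ hA, Measure.restrict_restrict hA]
  calc _ ≤ ∫⁻ x in A ∩ Set.Icc 0 1, 2 := by
        refine setLIntegral_mono' (hA.inter measurableSet_Icc) ?_
        intro x hx
        have h0 : 0 ≤ x := hx.2.1
        have h2 : (2:ENNReal) = ENNReal.ofReal 2 := by norm_num
        rw [h2]
        apply ENNReal.ofReal_le_ofReal
        have hl : (1/2:ℝ) ≤ Real.log 2 := by linarith [Real.log_two_gt_d9]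
        have h3 : (Real.log 2)⁻¹ ≤ 2 := by
          rw [inv_le_comm₀ (by linarith) (by norm_num)]; linarith
        have h4 : (1 + x)⁻¹ ≤ 1 := inv_le_one_of_one_le₀ (by linarith)
        have h5 : 0 ≤ (1+x)⁻¹ := by positivity
        nlinarith
    _ = 2 * volume (A ∩ Set.Icc 0 1) := by rw [setLIntegral_const]
    _ ≤ _ := mul_le_mul_right (measure_mono Set.inter_subset_left) _

lemma le_gm (A : Set ℝ) (hA : MeasurableSet A) (hs : A ⊆ Set.Icc 0 1) :
    volume A ≤ 2 * gaussMeasure A := by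
  rw [gaussMeasure, withDensity_apply _ hA, Measure.restrict_restrict hA,
    Set.inter_eq_left.2 hs, ← lintegral_const_mul' _ _ (by norm_num), ← one_mul (volume A),
    ← setLIntegral_const]
  refine setLIntegral_mono' hA ?_
  intro x hx
  have h0 := (hs hx).1
  have h1 := (hs hx).2
  have h2 : (2:ENNReal) = ENNReal.ofReal 2 := by norm_num
  rw [h2, ← ENNReal.ofReal_mul (by norm_num), ← ENNReal.ofReal_one]
  apply ENNReal.ofReal_le_ofReal
  have hl : 0 < Real.log 2 := Real.log_pos (by norm_num)
  have h3 : 1 ≤ (Real.log 2)⁻¹ := by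
    rw [one_le_inv₀ hl]; linarith [Real.log_two_lt_d9]
  have h4 : (1/2:ℝ) ≤ (1 + x)⁻¹ := by
    rw [le_inv_comm₀ (by norm_num) (by linarith)]; linarith
  nlinarith

lemma gm_ac : gaussMeasure ≪ volume :=
  (withDensity_absolutelyContinuous _ _).trans Measure.restrict_le_self.absolutelyContinuous

lemma gm_univ : gaussMeasure Set.univ = 1 := by
  have hl : 0 < Real.log 2 := Real.log_pos (by norm_num)
  rw [gaussMeasure, withDensity_apply _ MeasurableSet.univ, Measure.restrict_univ]
  have hc : ContinuousOn (fun x : ℝ => (Real.log 2)⁻¹ * (1 + x)⁻¹) (Set.Icc 0 1) := by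
    refine continuousOn_const.mul (ContinuousOn.inv₀ (by fun_prop) ?_)
    intro x hx; linarith [hx.1]
  rw [← ofReal_integral_eq_lintegral_ofReal]
  · rw [integral_Icc_eq_integral_Ioc, ← intervalIntegral.integral_of_le zero_le_one,
      intervalIntegral.integral_const_mul]
    have : ∫ x in (0:ℝ)..1, (1 + x)⁻¹ = Real.log 2 := by
      rw [intervalIntegral.integral_comp_add_left (fun x => x⁻¹) (1:ℝ),
        integral_inv_of_pos (by norm_num) (by norm_num)]
      norm_num
    rw [this, inv_mul_cancel₀ hl.ne']; simp
  · exact hc.integrableOn_Icc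
  · refine (ae_restrict_iff' measurableSet_Icc).2 (Eventually.of_forall fun x hx => ?_)
    have := hx.1
    show 0 ≤ _
    positivity

lemma main (d : ℕ) (P : ℕ → Set ℝ) (hP : ∀ k, IsF d (P k)) :
    (∑' k : ℕ, gaussMeasure (P k) ≠ ⊤ →
      gaussMeasure {x : ℝ | x ∈ Set.Ico (0 : ℝ) 1 ∧
        ∃ᶠ k : ℕ in Filter.atTop, gaussMap^[k] x ∈ P k} = 0) ∧
    (∑' k : ℕ, gaussMeasure (P k) = ⊤ →
      gaussMeasure {x : ℝ | x ∈ Set.Ico (0 : ℝ) 1 ∧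
        ∃ᶠ k : ℕ in Filter.atTop, gaussMap^[k] x ∈ P k} = 1) := by
  have hPs : ∀ k, P k ⊆ Set.Icc 0 1 := fun k x hx =>
    ⟨((hP k).1 hx).1.1.le, ((hP k).1 hx).1.2.le⟩
  constructor
  · intro hfin
    apply gm_ac
    have hsum : ∑' k, volume (X ∩ gaussMap^[k] ⁻¹' P k) ≠ ⊤ := by
      have : ∑' k, volume (X ∩ gaussMap^[k] ⁻¹' P k) ≤ ∑' k, 8 * gaussMeasure (P k) := by
        refine ENNReal.tsum_le_tsum fun k => ?_
        have h1 := (F_good (X_F k) (P k) (hP k).1 (F_meas (hP k))).2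
        rw [X_vol, one_mul] at h1
        refine h1.trans ((mul_le_mul_right (le_gm _ (F_meas (hP k)) (hPs k)) _).trans ?_)
        rw [← mul_assoc]
        norm_num
      rw [ENNReal.tsum_mul_left] at this
      exact (lt_of_le_of_lt this (ENNReal.mul_lt_top (by norm_num) hfin.lt_top)).ne
    have h0 := measure_limsup_atTop_eq_zero hsum
    have h1 := X_ae (Set.Ico 0 1) Set.Ico_subset_Icc_self
    refine measure_mono_null ?_ (measure_union_null h0 h1)
    rintro x ⟨hx, hf⟩
    by_cases hX : x ∈ X
    · left
      rw [Filter.mem_limsup_iff_frequently_mem]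
      exact hf.mono fun k hk => ⟨hX, hk⟩
    · exact Or.inr ⟨hx, hX⟩
  · intro htop
    have hdiv : ∑' k, volume (P k) = ⊤ := by
      have : ∑' k, gaussMeasure (P k) ≤ ∑' k, 2 * volume (P k) :=
        ENNReal.tsum_le_tsum fun k => gm_le _ (F_meas (hP k))
      rw [ENNReal.tsum_mul_left, htop, top_le_iff] at this
      by_contra hne
      exact ENNReal.mul_ne_top (by norm_num) hne this
    rw [← gm_univ]
    refine measure_congr ?_
    refine eventuallyEq_univ.2 ?_
    have hnull : volume ((⋃ m, ⋂ j, B P m j) ∪ (Set.Icc 0 1 \ X)) = 0 :=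
      measure_union_null (measure_iUnion_null fun m => B_null d P hP hdiv m)
        (X_ae _ subset_rfl)
    have hI : ∀ᵐ x ∂gaussMeasure, x ∈ Set.Icc (0:ℝ) 1 :=
      (withDensity_absolutelyContinuous _ _).ae_le (ae_restrict_mem measurableSet_Icc)
    have hN : ∀ᵐ x ∂gaussMeasure, x ∉ (⋃ m, ⋂ j, B P m j) ∪ (Set.Icc 0 1 \ X) :=
      measure_eq_zero_iff_ae_notMem.1 (gm_ac hnull)
    filter_upwards [hI, hN] with x hx hn
    have hX : x ∈ X := by
      by_contra h; exact hn (Or.inr ⟨hx, h⟩)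
    refine ⟨⟨hX.1.1.le, hX.1.2⟩, ?_⟩
    rw [Filter.frequently_atTop]
    intro m
    by_contra hcon
    push Not at hcon
    refine hn (Or.inl (Set.mem_iUnion.2 ⟨m, Set.mem_iInter.2 fun j => ⟨hX, fun k hk _ => hcon k hk⟩⟩))

end GBC

/-- Borel–Cantelli for the Gauss system: with `P_k = ⋃_{(a_1,…,a_d) ∈ C_k} I_d(a_1,…,a_d)`,
the Gauss measure of `{x ∈ [0,1) : T^k(x) ∈ P_k for infinitely many k}` is `0` if
`∑_k μ(P_k) < ∞` and `1` if `∑_k μ(P_k) = ∞`. -/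
theorem gauss_borel_cantelli (d : ℕ) (hd : 1 ≤ d) (C : ℕ → Set (Fin d → ℕ+)) :
    (∑' k : ℕ, gaussMeasure (⋃ a ∈ C k, cylinder d a) ≠ ⊤ →
      gaussMeasure {x : ℝ | x ∈ Set.Ico (0 : ℝ) 1 ∧
        ∃ᶠ k : ℕ in Filter.atTop, gaussMap^[k] x ∈ ⋃ a ∈ C k, cylinder d a} = 0) ∧
    (∑' k : ℕ, gaussMeasure (⋃ a ∈ C k, cylinder d a) = ⊤ →
      gaussMeasure {x : ℝ | x ∈ Set.Ico (0 : ℝ) 1 ∧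
        ∃ᶠ k : ℕ in Filter.atTop, gaussMap^[k] x ∈ ⋃ a ∈ C k, cylinder d a} = 1) := by
  exact GBC.main d _ (fun k => GBC.P_F d (C k))
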